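/- Let V be a finite type and G a simple graph on V that is a tree. Let ι be a nonempty finite index type and D : ι → Set V a family of subsets of V such that each D(i) is nonempty, the induced subgraph of G on each D(i) is connected, and D(i) ∩ D(j) is nonempty for every pair i, j. Then there is a vertex belonging to all of the sets: ⋂_i D(i) is nonempty. -/

import Mathlib

theorem kkm_aux {V : Type*} (G : SimpleGraph V) (hG : G.IsTree) (r : V) (D : Set V)
    (hconn : (G.induce D).Connected) (z : V) (hz : z ∈ D)
    (hmin : ∀ w ∈ D, G.dist r z ≤ G.dist r w) (y : V) (hy : y ∈ D) :
    ∃ p : G.Walk r y, p.IsPath ∧ z ∈ p.support ∧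
      ∀ w ∈ p.support, w ∈ D ∨ G.dist r w < G.dist r z := by
  classical
  obtain ⟨p, hp, hpl⟩ := hG.connected.exists_path_of_dist r z
  obtain ⟨q, hq⟩ := (hconn.preconnected ⟨z, hz⟩ ⟨y, hy⟩).exists_isPath
  have hp' : ∀ w ∈ p.support, w ≠ z → G.dist r w < G.dist r z := fun w hw hne => by
    have h1 := SimpleGraph.dist_le (p.takeUntil w hw)
    have h2 := SimpleGraph.Walk.length_takeUntil_lt hw hne
    omega
  let q' : G.Walk z y := q.map (SimpleGraph.Embedding.induce D).toHom
  have hq' : q'.IsPath :=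
    SimpleGraph.Walk.map_isPath_of_injective (SimpleGraph.Embedding.induce (G := G) D).injective hq
  have hqD : ∀ w ∈ q'.support, w ∈ D := by
    intro w hw
    have hw2 : w ∈ (q.map (SimpleGraph.Embedding.induce D).toHom).support := hw
    rw [SimpleGraph.Walk.support_map, List.mem_map] at hw2
    obtain ⟨a, -, rfl⟩ := hw2
    exact a.2
  refine ⟨p.append q', ?_, ?_, ?_⟩
  · rw [SimpleGraph.Walk.isPath_def, SimpleGraph.Walk.support_append, List.nodup_append']
    have hn := hq'.support_nodup
    rw [SimpleGraph.Walk.support_eq_cons, List.nodup_cons] at hn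
    refine ⟨hp.support_nodup, hn.2, ?_⟩
    intro w hw hw2
    by_cases hwz : w = z
    · subst hwz; exact hn.1 hw2
    · have := hp' w hw hwz
      have := hmin w (hqD w (List.mem_of_mem_tail hw2))
      omega
  · simp [SimpleGraph.Walk.mem_support_append_iff]
  · intro w hw
    rw [SimpleGraph.Walk.mem_support_append_iff] at hw
    rcases hw with hw | hw
    · by_cases hwz : w = z
      · subst hwz; exact Or.inl hz
      · exact Or.inr (hp' w hw hwz)
    · exact Or.inl (hqD w hw)

/-- **Tree KKM theorem for connected sets (discrete version).** Let `G` be a tree on a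
finite vertex type `V` and let `D : ι → Set V` be a finite family of nonempty subsets of
`V` whose induced subgraphs are connected and which pairwise intersect. Then the sets
`D i` have a common vertex. -/
theorem tree_kkm_connected_sets
    {V : Type*} [Fintype V] (G : SimpleGraph V) (hG : G.IsTree)
    {ι : Type*} [Fintype ι] [Nonempty ι] (D : ι → Set V)
    (hne : ∀ i, (D i).Nonempty)
    (hconn : ∀ i, (G.induce (D i)).Connected)
    (hpair : ∀ i j, (D i ∩ D j).Nonempty) :
    (⋂ i, D i).Nonempty := by
  obtain ⟨r⟩ := hG.connected.nonempty
  have hm : ∀ i, ∃ z ∈ D i, ∀ w ∈ D i, G.dist r z ≤ G.dist r w := fun i =>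
    Set.exists_min_image (D i) (fun w => G.dist r w) (Set.toFinite _) (hne i)
  choose z hz hmin using hm
  obtain ⟨i, hi⟩ := Finite.exists_max (fun i => G.dist r (z i))
  refine ⟨z i, Set.mem_iInter.2 fun j => ?_⟩
  obtain ⟨y, hyi, hyj⟩ := hpair i j
  obtain ⟨p, hp, hzp, -⟩ := kkm_aux G hG r (D i) (hconn i) (z i) (hz i) (hmin i) y hyi
  obtain ⟨q, hq, -, hqD⟩ := kkm_aux G hG r (D j) (hconn j) (z j) (hz j) (hmin j) y hyj
  have hpq : p = q := (hG.existsUnique_path r y).unique hp hq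
  subst hpq
  rcases hqD _ hzp with h | h
  · exact h
  · exact absurd (hi j) (not_le.2 h)
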